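/- Every modular form of level 1 is expressible in terms of eta-quotients: if f ∈ M_k(SL_2(Z)) then f is a polynomial with complex coefficients in the two series A(q) = η(q)^{16}/η(q^2)^8 + 256 η(q^2)^{16}/η(q)^8 and B(q) = η(q)^{24}/η(q^2)^{12} − 480 η(q^2)^{12} − 16896 η(q^2)^{12}η(q^4)^8/η(q)^8 + 8192 η(q^4)^{24}/η(q^2)^{12}. -/

import Mathlib

open Complex

/-- `∏_{n ≥ 1} (1 - q^n)` for a complex number `q` (the eta function without the
`q^(1/24)` factor). -/
noncomputable def etaC (q : ℂ) : ℂ := ∏' n : ℕ, (1 - q ^ (n + 1))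

/-- The eta-quotient expression `A(q) = η(q)^16/η(q²)^8 + 256·η(q²)^16/η(q)^8`
(equal to `E₄`); the fractional `q`-powers of the eta functions give the factor `q` in
the second term. -/
noncomputable def Aeta (q : ℂ) : ℂ :=
  etaC q ^ 16 / etaC (q ^ 2) ^ 8 + 256 * q * etaC (q ^ 2) ^ 16 / etaC q ^ 8

/-- The eta-quotient expression
`B(q) = η(q)^24/η(q²)^12 - 480·η(q²)^12 - 16896·η(q²)^12 η(q⁴)^8/η(q)^8
+ 8192·η(q⁴)^24/η(q²)^12` (equal to `E₆`); the fractional `q`-powers of the eta functions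
give the factors `q`, `q²`, `q³`. -/
noncomputable def Beta (q : ℂ) : ℂ :=
  etaC q ^ 24 / etaC (q ^ 2) ^ 12 - 480 * q * etaC (q ^ 2) ^ 12
    - 16896 * q ^ 2 * etaC (q ^ 2) ^ 12 * etaC (q ^ 4) ^ 8 / etaC q ^ 8
    + 8192 * q ^ 3 * etaC (q ^ 4) ^ 24 / etaC (q ^ 2) ^ 12

open UpperHalfPlane hiding I
open Filter ModularForm MatrixGroups
open scoped Topology Real

/-! ### The Euler product on the unit disc -/

lemma etaC_zero : etaC 0 = 1 := by simp [etaC]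

lemma etaC_ne_zero {q : ℂ} (hq : ‖q‖ < 1) : etaC q ≠ 0 := by
  have hlt (n : ℕ) : ‖q ^ (n + 1)‖ < 1 := by
    rw [norm_pow]
    exact pow_lt_one₀ (norm_nonneg _) hq n.succ_ne_zero
  simp only [etaC, sub_eq_add_neg]
  refine tprod_one_add_ne_zero_of_summable (f := fun n ↦ -q ^ (n + 1)) (fun n h ↦ ?_) ?_
  · have : q ^ (n + 1) = 1 := by linear_combination -h
    simpa [this] using hlt n
  · simpa using (summable_nat_add_iff 1).mpr (summable_geometric_of_lt_one (norm_nonneg _) hq)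

lemma differentiableOn_etaC : DifferentiableOn ℂ etaC (Metric.ball 0 1) :=
  differentiableOn_tprod_one_sub_pow

lemma multipliable_one_sub_odd_pow {q : ℂ} (hq : ‖q‖ < 1) :
    Multipliable fun n : ℕ ↦ 1 - q ^ (2 * n + 1) := by
  apply multipliable_one_add_of_summable (f := fun n ↦ -q ^ (2 * n + 1))
  have hq2 : ‖q‖ ^ 2 < 1 := pow_lt_one₀ (norm_nonneg _) hq two_ne_zero
  simpa [pow_succ, pow_mul] using
    (summable_geometric_of_lt_one (by positivity) hq2).mul_right ‖q‖

lemma norm_pow_lt_one {q : ℂ} (hq : ‖q‖ < 1) {n : ℕ} (hn : n ≠ 0) : ‖q ^ n‖ < 1 := by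
  rw [norm_pow]
  exact pow_lt_one₀ (norm_nonneg _) hq hn

lemma etaC_eq_odd_mul {q : ℂ} (hq : ‖q‖ < 1) :
    etaC q = (∏' n : ℕ, (1 - q ^ (2 * n + 1))) * etaC (q ^ 2) := by
  have he : (fun n : ℕ ↦ 1 - (q ^ 2) ^ (n + 1)) = fun n : ℕ ↦ 1 - q ^ (2 * n + 1 + 1) := by
    ext n
    ring
  have hm := multipliable_one_sub_pow (norm_pow_lt_one hq two_ne_zero)
  rw [he] at hm
  rw [etaC, etaC, he]
  exact (tprod_even_mul_odd (f := fun n ↦ 1 - q ^ (n + 1))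
    (multipliable_one_sub_odd_pow hq) hm).symm

lemma etaC_mul_etaC_neg_mul_etaC_pow_four {q : ℂ} (hq : ‖q‖ < 1) :
    etaC q * etaC (-q) * etaC (q ^ 4) = etaC (q ^ 2) ^ 3 := by
  have hn : ‖-q‖ < 1 := by simpa
  have hodd : (∏' n : ℕ, (1 - q ^ (2 * n + 1))) * (∏' n : ℕ, (1 - (-q) ^ (2 * n + 1))) =
      ∏' n : ℕ, (1 - (q ^ 2) ^ (2 * n + 1)) := by
    rw [← (multipliable_one_sub_odd_pow hq).tprod_mul (multipliable_one_sub_odd_pow hn)]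
    refine tprod_congr fun n ↦ ?_
    rw [Odd.neg_pow ⟨n, rfl⟩]
    ring
  have h2 := etaC_eq_odd_mul (norm_pow_lt_one hq two_ne_zero)
  rw [← hodd, ← pow_mul] at h2
  rw [etaC_eq_odd_mul hq, etaC_eq_odd_mul hn, neg_sq]
  linear_combination (-etaC (q ^ 2) ^ 2) * h2

/-! ### Fourth powers of the theta constants as functions of the nome -/

/-- The fourth power of the theta constant `θ₂`, as an eta quotient in the nome. -/
noncomputable def thetaTwoPowFour (x : ℂ) : ℂ := 16 * x * etaC (x ^ 4) ^ 8 / etaC (x ^ 2) ^ 4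

/-- The fourth power of the theta constant `θ₃`, as an eta quotient in the nome. -/
noncomputable def thetaThreePowFour (x : ℂ) : ℂ := etaC (-x) ^ 8 / etaC (x ^ 2) ^ 4

/-- The fourth power of the theta constant `θ₄`, as an eta quotient in the nome. -/
noncomputable def thetaFourPowFour (x : ℂ) : ℂ := etaC x ^ 8 / etaC (x ^ 2) ^ 4

lemma thetaTwoPowFour_neg (x : ℂ) : thetaTwoPowFour (-x) = -thetaTwoPowFour x := by
  simp only [thetaTwoPowFour, neg_sq, Even.neg_pow (show Even 4 by decide)]
  ring

lemma thetaThreePowFour_neg (x : ℂ) : thetaThreePowFour (-x) = thetaFourPowFour x := by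
  simp [thetaThreePowFour, thetaFourPowFour]

lemma thetaFourPowFour_neg (x : ℂ) : thetaFourPowFour (-x) = thetaThreePowFour x := by
  simp [thetaThreePowFour, thetaFourPowFour]

lemma thetaTwoPowFour_zero : thetaTwoPowFour 0 = 0 := by simp [thetaTwoPowFour]

lemma thetaThreePowFour_zero : thetaThreePowFour 0 = 1 := by simp [thetaThreePowFour, etaC_zero]

lemma thetaFourPowFour_zero : thetaFourPowFour 0 = 1 := by simp [thetaFourPowFour, etaC_zero]

lemma differentiableOn_etaC_comp {g : ℂ → ℂ} (hg : Differentiable ℂ g)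
    (hmaps : ∀ x, ‖x‖ < 1 → ‖g x‖ < 1) :
    DifferentiableOn ℂ (fun x ↦ etaC (g x)) (Metric.ball 0 1) :=
  differentiableOn_etaC.comp hg.differentiableOn fun x hx ↦ by
    simpa using hmaps x (by simpa using hx)

lemma etaC_pow_ne_zero {x : ℂ} (hx : x ∈ Metric.ball (0 : ℂ) 1) {n : ℕ} (hn : n ≠ 0) :
    etaC (x ^ n) ≠ 0 :=
  etaC_ne_zero (norm_pow_lt_one (by simpa using hx) hn)

lemma differentiableOn_thetaTwoPowFour :
    DifferentiableOn ℂ thetaTwoPowFour (Metric.ball 0 1) := by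
  have h4 := differentiableOn_etaC_comp (g := fun x ↦ x ^ 4) (by fun_prop)
    fun x hx ↦ norm_pow_lt_one hx four_ne_zero
  have h2 := differentiableOn_etaC_comp (g := fun x ↦ x ^ 2) (by fun_prop)
    fun x hx ↦ norm_pow_lt_one hx two_ne_zero
  exact (DifferentiableOn.mul (by fun_prop) (h4.pow 8)).div (h2.pow 4)
    fun x hx ↦ pow_ne_zero _ (etaC_pow_ne_zero hx two_ne_zero)

lemma differentiableOn_thetaThreePowFour :
    DifferentiableOn ℂ thetaThreePowFour (Metric.ball 0 1) := by
  have h1 := differentiableOn_etaC_comp (g := fun x ↦ -x) (by fun_prop) (by simp)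
  have h2 := differentiableOn_etaC_comp (g := fun x ↦ x ^ 2) (by fun_prop)
    fun x hx ↦ norm_pow_lt_one hx two_ne_zero
  exact (h1.pow 8).div (h2.pow 4) fun x hx ↦ pow_ne_zero _ (etaC_pow_ne_zero hx two_ne_zero)

lemma differentiableOn_thetaFourPowFour :
    DifferentiableOn ℂ thetaFourPowFour (Metric.ball 0 1) := by
  have h2 := differentiableOn_etaC_comp (g := fun x ↦ x ^ 2) (by fun_prop)
    fun x hx ↦ norm_pow_lt_one hx two_ne_zero
  exact (differentiableOn_etaC.pow 8).div (h2.pow 4)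
    fun x hx ↦ pow_ne_zero _ (etaC_pow_ne_zero hx two_ne_zero)

lemma thetaPowFour_prod {x : ℂ} (hx : ‖x‖ < 1) :
    thetaTwoPowFour x * thetaThreePowFour x * thetaFourPowFour x = 16 * x * etaC (x ^ 2) ^ 12 := by
  have h2 := etaC_ne_zero (norm_pow_lt_one hx two_ne_zero)
  have h := etaC_mul_etaC_neg_mul_etaC_pow_four hx
  simp only [thetaTwoPowFour, thetaThreePowFour, thetaFourPowFour]
  field_simp
  calc _ = x * (etaC x * etaC (-x) * etaC (x ^ 4)) ^ 8 := by ring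
    _ = _ := by
      rw [h]
      ring

lemma thetaThreePowFour_mul_thetaFourPowFour {x : ℂ} (hx : ‖x‖ < 1) :
    thetaThreePowFour x * thetaFourPowFour x = thetaFourPowFour (x ^ 2) ^ 2 := by
  have h2 := etaC_ne_zero (norm_pow_lt_one hx two_ne_zero)
  have h4 := etaC_ne_zero (norm_pow_lt_one hx four_ne_zero)
  have h := etaC_mul_etaC_neg_mul_etaC_pow_four hx
  simp only [thetaThreePowFour, thetaFourPowFour, ← pow_mul, Nat.reduceMul]
  field_simp
  calc _ = (etaC x * etaC (-x) * etaC (x ^ 4)) ^ 8 := by ring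
    _ = _ := by
      rw [h]
      ring

lemma thetaTwoPowFour_sq_mul_thetaThreePowFour_sq {x : ℂ} (hx : ‖x‖ < 1) :
    16 * (thetaTwoPowFour (x ^ 2) * thetaThreePowFour (x ^ 2)) = thetaTwoPowFour x ^ 2 := by
  have hx2 := norm_pow_lt_one hx two_ne_zero
  have h2 := etaC_ne_zero hx2
  have h4 := etaC_ne_zero (norm_pow_lt_one hx four_ne_zero)
  have h := thetaPowFour_prod hx2
  have hne : thetaFourPowFour (x ^ 2) ≠ 0 := by
    rw [thetaFourPowFour, ← pow_mul]
    exact div_ne_zero (pow_ne_zero _ h2) (pow_ne_zero _ h4)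
  refine mul_right_cancel₀ hne ?_
  rw [mul_assoc, h, thetaTwoPowFour, thetaFourPowFour, ← pow_mul]
  field_simp

/-! ### Transformation under the generators of the modular group -/

/-- The nome `exp (π i z)`. -/
noncomputable def nome (z : ℍ) : ℂ := cexp (π * I * z)

lemma nome_sq (z : ℍ) : nome z ^ 2 = cexp (2 * π * I * z) := by
  rw [nome, ← Complex.exp_nat_mul]
  ring_nf

lemma nome_eq_qParam (z : ℍ) : nome z = Function.Periodic.qParam 2 z := by
  rw [nome, Function.Periodic.qParam]
  congr 1
  push_cast
  ring

lemma norm_nome_lt_one (z : ℍ) : ‖nome z‖ < 1 := by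
  simpa [nome_eq_qParam] using norm_qParam_lt_one 2 z

lemma tendsto_nome : Tendsto nome atImInfty (𝓝 0) := by
  simpa only [← funext nome_eq_qParam] using qParam_tendsto_atImInfty (h := 2) two_pos

lemma nome_T_smul (z : ℍ) : nome (ModularGroup.T • z) = -nome z := by
  rw [modular_T_smul, nome, nome, coe_vadd]
  push_cast
  rw [mul_add, mul_one, Complex.exp_add, Complex.exp_pi_mul_I]
  ring

lemma eta_eq_exp_mul_etaC (z : ℂ) :
    η z = cexp (2 * π * I * z / 24) * etaC (cexp (2 * π * I * z)) := by
  simp [ModularForm.eta, etaC, eta_q_eq_pow, Function.Periodic.qParam]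

lemma thetaTwoPowFour_nome (z : ℍ) :
    thetaTwoPowFour (nome z) = 16 * η (2 * z) ^ 8 / η z ^ 4 := by
  have h4 : nome z ^ 4 = cexp (2 * π * I * (2 * z)) := by
    rw [nome, ← Complex.exp_nat_mul]
    ring_nf
  have h2 := etaC_ne_zero (norm_pow_lt_one (norm_nome_lt_one z) two_ne_zero)
  rw [eta_eq_exp_mul_etaC, eta_eq_exp_mul_etaC, ← nome_sq, ← h4, thetaTwoPowFour]
  have he : cexp (2 * π * I * (2 * z) / 24) ^ 8 = nome z * cexp (2 * π * I * z / 24) ^ 4 := by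
    rw [nome, ← Complex.exp_nat_mul, ← Complex.exp_nat_mul, ← Complex.exp_add]
    ring_nf
  rw [mul_pow, mul_pow, he]
  have := Complex.exp_ne_zero (2 * π * I * z / 24)
  field_simp

lemma thetaFourPowFour_nome (z : ℍ) :
    thetaFourPowFour (nome z) = η (z / 2) ^ 8 / η z ^ 4 := by
  have h1 : nome z = cexp (2 * π * I * (z / 2)) := by
    rw [nome]
    ring_nf
  have h2 := etaC_ne_zero (norm_pow_lt_one (norm_nome_lt_one z) two_ne_zero)
  rw [eta_eq_exp_mul_etaC, eta_eq_exp_mul_etaC, ← nome_sq, ← h1, thetaFourPowFour]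
  have he : cexp (2 * π * I * (z / 2) / 24) ^ 8 = cexp (2 * π * I * z / 24) ^ 4 := by
    rw [← Complex.exp_nat_mul, ← Complex.exp_nat_mul]
    ring_nf
  rw [mul_pow, mul_pow, he]
  have := Complex.exp_ne_zero (2 * π * I * z / 24)
  field_simp

lemma thetaPowFour_prod_nome (z : ℍ) :
    thetaTwoPowFour (nome z) * thetaThreePowFour (nome z) * thetaFourPowFour (nome z) =
      16 * η z ^ 12 := by
  rw [thetaPowFour_prod (norm_nome_lt_one z), eta_eq_exp_mul_etaC, ← nome_sq, mul_pow,
    ← Complex.exp_nat_mul, nome]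
  ring_nf

lemma eta_neg_inv_pow_four {w : ℂ} (hw : 0 < w.im) : η (-1 / w) ^ 4 = -w ^ 2 * η w ^ 4 := by
  have h := eta_comp_eq_csqrt_I_inv (show w ∈ upperHalfPlaneSet from hw)
  have hs (u : ℂ) : sqrt u ^ 4 = u ^ 2 := by
    rw [show (4 : ℕ) = 2 * 2 from rfl, pow_mul, Complex.sqrt, cpow_ofNat_inv_pow]
  simp only [Function.comp_apply, Pi.smul_apply, Pi.mul_apply, smul_eq_mul] at h
  rw [h, mul_pow, mul_pow, inv_pow, hs, hs, I_sq]
  ring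

lemma coe_S_smul (z : ℍ) : ((ModularGroup.S • z : ℍ) : ℂ) = -1 / z := by
  rw [modular_S_smul]
  simp [neg_div]

lemma thetaTwoPowFour_nome_S_smul (z : ℍ) :
    thetaTwoPowFour (nome (ModularGroup.S • z)) = -z ^ 2 * thetaFourPowFour (nome z) := by
  have hz := z.ne_zero
  have hη := eta_ne_zero z.2
  have h1 := eta_neg_inv_pow_four z.2
  have h2 := eta_neg_inv_pow_four (w := z / 2) (by simpa using z.2)
  rw [thetaTwoPowFour_nome, thetaFourPowFour_nome, coe_S_smul,
    show 2 * (-1 / (z : ℂ)) = -1 / (z / 2) by field_simp,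
    show 8 = 4 * 2 from rfl, pow_mul, pow_mul, h1, h2]
  field_simp
  ring

lemma thetaFourPowFour_nome_S_smul (z : ℍ) :
    thetaFourPowFour (nome (ModularGroup.S • z)) = -z ^ 2 * thetaTwoPowFour (nome z) := by
  have hz := z.ne_zero
  have hη := eta_ne_zero z.2
  have h1 := eta_neg_inv_pow_four z.2
  have h2 := eta_neg_inv_pow_four (w := 2 * z) (by simpa using z.2)
  rw [thetaTwoPowFour_nome, thetaFourPowFour_nome, coe_S_smul,
    show (-1 / (z : ℂ)) / 2 = -1 / (2 * z) by field_simp,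
    show 8 = 4 * 2 from rfl, pow_mul, pow_mul, h1, h2]
  field_simp
  ring

lemma thetaThreePowFour_nome_S_smul (z : ℍ) :
    thetaThreePowFour (nome (ModularGroup.S • z)) = -z ^ 2 * thetaThreePowFour (nome z) := by
  have hz := z.ne_zero
  have h := thetaPowFour_prod_nome (ModularGroup.S • z)
  have h0 := thetaPowFour_prod_nome z
  have hne : thetaTwoPowFour (nome z) * thetaFourPowFour (nome z) ≠ 0 := by
    intro h'
    refine pow_ne_zero 12 (eta_ne_zero z.2) ?_
    linear_combination thetaThreePowFour (nome z) / 16 * h' - h0 / 16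
  rw [thetaTwoPowFour_nome_S_smul, thetaFourPowFour_nome_S_smul, coe_S_smul,
    show 12 = 4 * 3 from rfl, pow_mul, eta_neg_inv_pow_four z.2] at h
  refine mul_right_cancel₀ (mul_ne_zero (pow_ne_zero 4 hz) hne) ?_
  linear_combination h + z ^ 6 * h0


/-! ### Level one forms given as functions of the nome -/

lemma exists_modularForm_of_nome {F : ℂ → ℂ} (hF : DifferentiableOn ℂ F (Metric.ball 0 1)) {k : ℤ}
    (hT : ∀ x, F (-x) = F x)
    (hS : ∀ z : ℍ, F (nome (ModularGroup.S • z)) = (z : ℂ) ^ k * F (nome z)) :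
    ∃ f : ModularForm 𝒮ℒ k, (∀ z, f z = F (nome z)) ∧ (qExpansion 1 f).coeff 0 = F 0 := by
  have hslash (γ : SL(2, ℤ)) : (fun z ↦ F (nome z)) ∣[k] γ = fun z ↦ F (nome z) := by
    refine SlashInvariantForm.slash_action_generators_SL2Z ?_ ?_ γ
    · ext z
      rw [SL_slash_apply, hS, ModularGroup.denom_S, mul_right_comm,
        ← zpow_add₀ z.ne_zero, add_neg_cancel, zpow_zero, one_mul]
    · ext z
      rw [SL_slash_apply, nome_T_smul, hT, ModularGroup.denom_apply]
      simp [ModularGroup.T]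
  have hlim : Tendsto (fun z ↦ F (nome z)) atImInfty (𝓝 (F 0)) :=
    ((hF.differentiableAt (Metric.ball_mem_nhds 0 one_pos)).continuousAt.tendsto).comp tendsto_nome
  let f : ModularForm 𝒮ℒ k :=
    { toFun z := F (nome z)
      slash_action_eq' := fun _ ⟨γ, hγ⟩ ↦ hγ ▸ hslash γ
      holo' := by
        rw [UpperHalfPlane.mdifferentiable_iff]
        refine (hF.comp (f := fun w : ℂ ↦ cexp (π * I * w)) (by fun_prop) (s := upperHalfPlaneSet)
          fun w hw ↦ ?_).congr fun w hw ↦ ?_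
        · simpa [nome] using norm_nome_lt_one ⟨w, hw⟩
        · simp [nome, ofComplex_apply_of_im_pos hw]
      bdd_at_cusps' {c} hc := by
        rw [Subgroup.IsArithmetic.isCusp_iff_isCusp_SL2Z] at hc
        rw [OnePoint.isBoundedAt_iff_forall_SL2Z hc]
        intro γ _
        rw [hslash γ]
        exact hlim.isBigO_one ℝ }
  refine ⟨f, fun _ ↦ rfl, ?_⟩
  rw [qExpansion_coeff_zero one_pos
    (ModularFormClass.analyticAt_cuspFunction_zero f one_pos one_mem_strictPeriods_SL)
    (SlashInvariantFormClass.periodic_comp_ofComplex f one_mem_strictPeriods_SL)]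
  exact hlim.limUnder_eq

lemma eq_of_weight_lt_twelve_of_coeff_zero_eq {k : ℤ} (hk : k < 12) {f g : ModularForm 𝒮ℒ k}
    (h : (qExpansion 1 f).coeff 0 = (qExpansion 1 g).coeff 0) : f = g := by
  have h0 : (qExpansion 1 (f - g)).coeff 0 = 0 := by
    rw [ModularForm.qExpansion_sub one_pos one_mem_strictPeriods_SL, map_sub, h, sub_self]
  have hc := rank_zero_iff_forall_zero.mp (CuspForm.rank_eq_zero_of_weight_lt_twelve hk)
    (toCuspForm (f - g) h0)
  ext z
  exact sub_eq_zero.mp (DFunLike.congr_fun hc z)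

lemma thetaThreePowFour_eq_add_nome (z : ℍ) :
    thetaThreePowFour (nome z) = thetaTwoPowFour (nome z) + thetaFourPowFour (nome z) := by
  have hd : DifferentiableOn ℂ
      (fun x ↦ (thetaThreePowFour x - thetaTwoPowFour x - thetaFourPowFour x) ^ 2)
      (Metric.ball 0 1) :=
    ((differentiableOn_thetaThreePowFour.sub differentiableOn_thetaTwoPowFour).sub
      differentiableOn_thetaFourPowFour).pow 2
  obtain ⟨f, hf, hf0⟩ := exists_modularForm_of_nome (k := 4) hd
    (fun x ↦ by
      rw [thetaThreePowFour_neg, thetaTwoPowFour_neg, thetaFourPowFour_neg]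
      ring)
    fun z ↦ by
      rw [thetaThreePowFour_nome_S_smul, thetaTwoPowFour_nome_S_smul,
        thetaFourPowFour_nome_S_smul, zpow_ofNat]
      ring
  have h : f = 0 := eq_of_weight_lt_twelve_of_coeff_zero_eq (by norm_num) <| by
    rw [hf0, thetaThreePowFour_zero, thetaTwoPowFour_zero, thetaFourPowFour_zero]
    simp [qExpansion_zero]
  have hz := hf z
  rw [h, zero_apply, eq_comm, sq_eq_zero_iff] at hz
  linear_combination hz

lemma exists_nome_eq {x : ℂ} (hx : ‖x‖ < 1) (hx0 : x ≠ 0) : ∃ z : ℍ, nome z = x :=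
  ⟨⟨_, Function.Periodic.im_invQParam_pos_of_norm_lt_one two_pos hx hx0⟩, by
    rw [nome_eq_qParam]
    exact Function.Periodic.qParam_right_inv two_ne_zero hx0⟩

/-- Jacobi's identity `θ₃⁴ = θ₂⁴ + θ₄⁴`. -/
lemma thetaThreePowFour_eq_add {x : ℂ} (hx : ‖x‖ < 1) :
    thetaThreePowFour x = thetaTwoPowFour x + thetaFourPowFour x := by
  rcases eq_or_ne x 0 with rfl | hx0
  · simp [thetaThreePowFour_zero, thetaTwoPowFour_zero, thetaFourPowFour_zero]
  · obtain ⟨z, rfl⟩ := exists_nome_eq hx hx0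
    exact thetaThreePowFour_eq_add_nome z

/-- The duplication formula `2 (θ₂⁴ + θ₃⁴)(2z) = (θ₃⁴ + θ₄⁴)(z)`. -/
lemma two_mul_thetaTwoPowFour_sq_add_thetaThreePowFour_sq {x : ℂ} (hx : ‖x‖ < 1) :
    2 * (thetaTwoPowFour (x ^ 2) + thetaThreePowFour (x ^ 2)) =
      thetaThreePowFour x + thetaFourPowFour x := by
  have hmaps : Set.MapsTo (fun x : ℂ ↦ x ^ 2) (Metric.ball 0 1) (Metric.ball 0 1) := fun x hx ↦ by
    simpa using norm_pow_lt_one (q := x) (by simpa using hx) two_ne_zero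
  have hsq : DifferentiableOn ℂ (fun x : ℂ ↦ x ^ 2) (Metric.ball 0 1) := by fun_prop
  have hF : DifferentiableOn ℂ
      (fun x ↦ 2 * (thetaTwoPowFour (x ^ 2) + thetaThreePowFour (x ^ 2))) (Metric.ball 0 1) :=
    ((differentiableOn_thetaTwoPowFour.comp hsq hmaps).add
      (differentiableOn_thetaThreePowFour.comp hsq hmaps)).const_mul 2
  have hG := differentiableOn_thetaThreePowFour.add differentiableOn_thetaFourPowFour
  have hmul (y : ℂ) (hy : y ∈ Metric.ball (0 : ℂ) 1) :
      (2 * (thetaTwoPowFour (y ^ 2) + thetaThreePowFour (y ^ 2)) -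
          (thetaThreePowFour y + thetaFourPowFour y)) *
        (2 * (thetaTwoPowFour (y ^ 2) + thetaThreePowFour (y ^ 2)) +
          (thetaThreePowFour y + thetaFourPowFour y)) = 0 := by
    have hy : ‖y‖ < 1 := by simpa using hy
    have h34 := thetaThreePowFour_mul_thetaFourPowFour hy
    have h23 := thetaTwoPowFour_sq_mul_thetaThreePowFour_sq hy
    have hJ := thetaThreePowFour_eq_add hy
    have hJ2 := thetaThreePowFour_eq_add (norm_pow_lt_one hy two_ne_zero)
    rw [hJ] at h34 ⊢
    rw [hJ2] at h23 ⊢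
    linear_combination h23 - 4 * h34
  rcases ((hF.sub hG).analyticOnNhd Metric.isOpen_ball).eq_zero_or_eq_zero_of_mul_eq_zero
    ((hF.add hG).analyticOnNhd Metric.isOpen_ball) hmul
    (convex_ball (0 : ℂ) 1).isPreconnected with h | h
  · exact sub_eq_zero.mp (h x (by simpa using hx))
  · have := h 0 (by simp)
    norm_num [thetaTwoPowFour_zero, thetaThreePowFour_zero, thetaFourPowFour_zero] at this

/-! ### The eta quotients are Eisenstein series -/

lemma Aeta_sq_eq {x : ℂ} (hx : ‖x‖ < 1) :
    Aeta (x ^ 2) = thetaTwoPowFour x ^ 2 + thetaThreePowFour x * thetaFourPowFour x := by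
  have hx2 := norm_pow_lt_one hx two_ne_zero
  have h2 := etaC_ne_zero hx2
  have h4 := etaC_ne_zero (norm_pow_lt_one hx four_ne_zero)
  rw [thetaThreePowFour_mul_thetaFourPowFour hx]
  simp only [Aeta, thetaTwoPowFour, thetaFourPowFour, ← pow_mul, Nat.reduceMul]
  field_simp
  ring

lemma Beta_eq {q : ℂ} (hq : ‖q‖ < 1) :
    Beta q = (thetaTwoPowFour q + thetaThreePowFour q) *
      (thetaFourPowFour q ^ 2 - 32 * (thetaTwoPowFour q * thetaThreePowFour q)) := by
  have h1 := etaC_ne_zero hq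
  have h2 := etaC_ne_zero (norm_pow_lt_one hq two_ne_zero)
  have hP := thetaPowFour_prod hq
  have hB : Beta q = thetaFourPowFour q ^ 3 - 30 * (16 * q * etaC (q ^ 2) ^ 12)
      - 66 * (16 * q * etaC (q ^ 2) ^ 12) * (thetaTwoPowFour q / thetaFourPowFour q)
      + 2 * thetaTwoPowFour q ^ 3 := by
    simp only [Beta, thetaTwoPowFour, thetaFourPowFour]
    field_simp
    ring
  have hne : thetaFourPowFour q ≠ 0 := div_ne_zero (pow_ne_zero _ h1) (pow_ne_zero _ h2)
  rw [hB, ← hP, thetaThreePowFour_eq_add hq]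
  field_simp
  ring

lemma Aeta_eq_E₄ (z : ℍ) : Aeta (cexp (2 * π * I * z)) = E₄ z := by
  have hd : DifferentiableOn ℂ
      (fun x ↦ thetaTwoPowFour x ^ 2 + thetaThreePowFour x * thetaFourPowFour x)
      (Metric.ball 0 1) :=
    (differentiableOn_thetaTwoPowFour.pow 2).add
      (differentiableOn_thetaThreePowFour.mul differentiableOn_thetaFourPowFour)
  obtain ⟨f, hf, hf0⟩ := exists_modularForm_of_nome (k := 4) hd
    (fun x ↦ by
      rw [thetaThreePowFour_neg, thetaTwoPowFour_neg, thetaFourPowFour_neg]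
      ring)
    fun z ↦ by
      rw [thetaThreePowFour_nome_S_smul, thetaTwoPowFour_nome_S_smul,
        thetaFourPowFour_nome_S_smul, thetaThreePowFour_eq_add_nome, zpow_ofNat]
      ring
  have h : f = E₄ := eq_of_weight_lt_twelve_of_coeff_zero_eq (by norm_num) <| by
    rw [hf0, thetaThreePowFour_zero, thetaTwoPowFour_zero, thetaFourPowFour_zero]
    exact .trans (by norm_num) (EisensteinSeries.E_qExpansion_coeff_zero _ (by decide)).symm
  rw [← nome_sq, Aeta_sq_eq (norm_nome_lt_one z), ← hf, h]

lemma Beta_eq_E₆ (z : ℍ) : Beta (cexp (2 * π * I * z)) = E₆ z := by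
  have hd : DifferentiableOn ℂ
      (fun x ↦ (thetaTwoPowFour x + thetaThreePowFour x) *
        (thetaThreePowFour x + thetaFourPowFour x) *
        (thetaFourPowFour x - thetaTwoPowFour x) * (1 / 2)) (Metric.ball 0 1) :=
    (((differentiableOn_thetaTwoPowFour.add differentiableOn_thetaThreePowFour).mul
      (differentiableOn_thetaThreePowFour.add differentiableOn_thetaFourPowFour)).mul
      (differentiableOn_thetaFourPowFour.sub differentiableOn_thetaTwoPowFour)).mul_const _
  obtain ⟨f, hf, hf0⟩ := exists_modularForm_of_nome (k := 6) hd
    (fun x ↦ by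
      rw [thetaThreePowFour_neg, thetaTwoPowFour_neg, thetaFourPowFour_neg]
      ring)
    fun z ↦ by
      rw [thetaThreePowFour_nome_S_smul, thetaTwoPowFour_nome_S_smul,
        thetaFourPowFour_nome_S_smul, zpow_ofNat]
      ring
  have h : f = E₆ := eq_of_weight_lt_twelve_of_coeff_zero_eq (by norm_num) <| by
    rw [hf0, thetaThreePowFour_zero, thetaTwoPowFour_zero, thetaFourPowFour_zero]
    exact .trans (by norm_num) (EisensteinSeries.E_qExpansion_coeff_zero _ (by decide)).symm
  have hx := norm_nome_lt_one z
  have h34 := thetaThreePowFour_mul_thetaFourPowFour hx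
  have h23 := thetaTwoPowFour_sq_mul_thetaThreePowFour_sq hx
  have hsum := two_mul_thetaTwoPowFour_sq_add_thetaThreePowFour_sq hx
  have hJ := thetaThreePowFour_eq_add hx
  rw [← nome_sq, Beta_eq (norm_pow_lt_one hx two_ne_zero), ← h34,
    show 32 * (thetaTwoPowFour (nome z ^ 2) * thetaThreePowFour (nome z ^ 2)) =
      2 * thetaTwoPowFour (nome z) ^ 2 by rw [← h23]; ring,
    show thetaTwoPowFour (nome z ^ 2) + thetaThreePowFour (nome z ^ 2) =
      (thetaThreePowFour (nome z) + thetaFourPowFour (nome z)) / 2 by rw [← hsum]; ring,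
    ← h, hf, hJ]
  ring

/-! ### Generation by the Eisenstein series of weights four and six -/

lemma exists_four_mul_add_six_mul_eq {k : ℤ} (hk : Even k) (h0 : 0 ≤ k) (h2 : k ≠ 2) :
    ∃ i j : ℕ, (i : ℤ) * 4 + (j : ℤ) * 6 = k := by
  obtain ⟨m, rfl⟩ := hk
  obtain ⟨l, rfl | rfl⟩ := m.even_or_odd'
  · exact ⟨l.toNat, 0, by lia⟩
  · exact ⟨(l - 1).toNat, 1, by lia⟩

lemma exists_eval_E₄_E₆ (k : ℤ) (f : ModularForm 𝒮ℒ k) :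
    ∃ P : MvPolynomial (Fin 2) ℂ, ∀ z : ℍ, f z = MvPolynomial.eval ![E₄ z, E₆ z] P := by
  induction hn : k.toNat using Nat.strong_induction_on generalizing k with
  | _ n ih =>
  rcases Int.even_or_odd k with hk | hk
  swap
  · exact ⟨0, by simp [levelOne_odd_weight_eq_zero hk f]⟩
  rcases lt_or_ge k 0 with h0 | h0
  · exact ⟨0, by simp [ModularFormClass.levelOne_neg_weight_eq_zero h0 f]⟩
  rcases eq_or_ne k 2 with rfl | h2
  · exact ⟨0, by simp [rank_zero_iff_forall_zero.mp levelOne_weight_two_rank_zero f]⟩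
  obtain ⟨i, j, hij⟩ := exists_four_mul_add_six_mul_eq hk h0 h2
  let m : ModularForm 𝒮ℒ k := ((E₄.pow i).mul (E₆.pow j)).mcast hij
  have hm (z : ℍ) : m z = E₄ z ^ i * E₆ z ^ j := by
    simp [m]
  have hm0 : (qExpansion 1 m).coeff 0 = 1 := by
    change (qExpansion 1 ((E₄.pow i).mul (E₆.pow j))).coeff 0 = 1
    rw [ModularForm.qExpansion_mul one_pos one_mem_strictPeriods_SL,
      ModularForm.qExpansion_pow one_pos one_mem_strictPeriods_SL,
      ModularForm.qExpansion_pow one_pos one_mem_strictPeriods_SL]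
    have h4 := EisensteinSeries.E_qExpansion_coeff_zero (k := 4) (by norm_num) (by decide)
    have h6 := EisensteinSeries.E_qExpansion_coeff_zero (k := 6) (by norm_num) (by decide)
    rw [PowerSeries.coeff_zero_eq_constantCoeff_apply] at h4 h6 ⊢
    rw [map_mul, map_pow, map_pow, h4, h6]
    simp
  let c := (qExpansion 1 f).coeff 0
  have h0' : (qExpansion 1 ⇑(f - c • m)).coeff 0 = 0 :=
    (isCuspForm_iff_coeffZero_eq_zero _).mp (sub_smul_isCuspForm f m hm0)
  let g := CuspForm.discriminantEquiv (toCuspForm (f - c • m) h0')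
  have hfg (z : ℍ) : f z = c * (E₄ z ^ i * E₆ z ^ j) + (E₄ z ^ 3 - E₆ z ^ 2) / 1728 * g z := by
    rw [← discriminant_eq_E₄_cube_sub_E₆_sq, discriminant_mul_discriminantEquiv_apply,
      toCuspForm_apply, ← hm]
    simp
  obtain ⟨Q, hQ⟩ : ∃ Q : MvPolynomial (Fin 2) ℂ, ∀ z : ℍ,
      g z = MvPolynomial.eval ![E₄ z, E₆ z] Q := by
    rcases lt_or_ge k 12 with h12 | h12
    · exact ⟨0, by simp [ModularFormClass.levelOne_neg_weight_eq_zero (by lia) g]⟩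
    · exact ih (k - 12).toNat (by lia) _ g rfl
  refine ⟨.C c * (.X 0 ^ i * .X 1 ^ j) + .C (1 / 1728) * (.X 0 ^ 3 - .X 1 ^ 2) * Q, fun z ↦ ?_⟩
  rw [hfg, hQ]
  simp only [map_add, map_mul, map_sub, map_pow, MvPolynomial.eval_C, MvPolynomial.eval_X,
    Matrix.cons_val_zero, Matrix.cons_val_one]
  ring

/-- Every modular form of level 1 is a polynomial (with complex coefficients) in the two
eta-quotient expressions `A` and `B`, evaluated at the nome `q = exp(2πiz)`. -/
theorem level_one_forms_poly_in_eta_quotients (k : ℤ)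
    (f : ModularForm (⊤ : Subgroup (Matrix.SpecialLinearGroup (Fin 2) ℤ)) k) :
    ∃ P : MvPolynomial (Fin 2) ℂ, ∀ z : UpperHalfPlane,
      f z = MvPolynomial.eval
        (![Aeta (Complex.exp (2 * Real.pi * Complex.I * (z : ℂ))),
           Beta (Complex.exp (2 * Real.pi * Complex.I * (z : ℂ)))]) P := by
  obtain ⟨P, hP⟩ := exists_eval_E₄_E₆ k (f.mcast rfl (MonoidHom.range_eq_map _))
  refine ⟨P, fun z ↦ ?_⟩
  rw [Aeta_eq_E₄, Beta_eq_E₆, ← hP]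
  rfl
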